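/- Let ℓ, n be positive integers with ℓ ≤ n and ℓ ≤ 3, and let S be a subset of S_ℓ. Then Comp^n(S) is (the underlying set of) a subgroup of S_n if and only if S is (the underlying set of) a subgroup of S_ℓ. -/

import Mathlib

open Equiv Finset Function

/-- `h_I : [ℓ] → [n]`: the increasing enumeration of an `ℓ`-element subset `I ⊆ [n]`,
i.e., the unique order isomorphism `([ℓ], ≤) → (I, ≤)` viewed as a map into `[n]`. -/
def hmap {ℓ n : ℕ} (I : Finset (Fin n)) (hI : I.card = ℓ) : Fin ℓ → Fin n :=
  fun i => ((I.orderIsoOfFin hI) i : Fin n)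

theorem hmap_injective {ℓ n : ℕ} (I : Finset (Fin n)) (hI : I.card = ℓ) :
    Function.Injective (hmap I hI) := fun a b h =>
  (I.orderIsoOfFin hI).injective (Subtype.ext h)

theorem mem_image_iff_perm {n : ℕ} (π : Equiv.Perm (Fin n)) (I : Finset (Fin n)) (a : Fin n) :
    a ∈ I ↔ π a ∈ I.image ⇑π := by
  constructor
  · exact fun h => Finset.mem_image_of_mem _ h
  · intro h
    obtain ⟨b, hb, hba⟩ := Finset.mem_image.mp h
    rwa [← π.injective hba]

/-- The pattern `π_I := h_{π(I)}⁻¹ ∘ π ∘ h_I ∈ S_ℓ` of `π ∈ S_n` at an `ℓ`-element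
subset `I ⊆ [n]`. -/
def patt {ℓ n : ℕ} (π : Equiv.Perm (Fin n)) (I : Finset (Fin n)) (hI : I.card = ℓ) :
    Equiv.Perm (Fin ℓ) :=
  (I.orderIsoOfFin hI).toEquiv.trans
    ((π.subtypeEquiv (mem_image_iff_perm π I)).trans
      ((I.image ⇑π).orderIsoOfFin
        (by rw [Finset.card_image_of_injective _ π.injective, hI])).toEquiv.symm)

/-- `Pat_ℓ(π)`: the set of `ℓ`-patterns of `π ∈ S_n`. -/
def PattSet (ℓ : ℕ) {n : ℕ} (π : Equiv.Perm (Fin n)) : Set (Equiv.Perm (Fin ℓ)) :=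
  {σ | ∃ (I : Finset (Fin n)) (hI : I.card = ℓ), σ = patt π I hI}

/-- `Comp^n(S)`: the set of `n`-permutations all of whose `ℓ`-patterns lie in `S`. -/
def CompSet (n : ℕ) {ℓ : ℕ} (S : Set (Equiv.Perm (Fin ℓ))) : Set (Equiv.Perm (Fin n)) :=
  {τ | PattSet ℓ τ ⊆ S}

/-- Pattern involvement: `σ ≤ π` iff `σ = π_I` for some `ℓ`-element subset `I`. -/
def Involves {ℓ n : ℕ} (σ : Equiv.Perm (Fin ℓ)) (π : Equiv.Perm (Fin n)) : Prop :=
  σ ∈ PattSet ℓ π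

/-- `gPat_ℓ(H)`: the subgroup of `S_ℓ` generated by the `ℓ`-patterns of members of `H`. -/
def gPat (ℓ : ℕ) {n : ℕ} (H : Set (Equiv.Perm (Fin n))) : Subgroup (Equiv.Perm (Fin ℓ)) :=
  Subgroup.closure (⋃ τ ∈ H, PattSet ℓ τ)

/-- A function preserves a `k`-ary relation (componentwise application keeps tuples in
the relation). -/
def Preserves {α : Type*} {k : ℕ} (f : α → α) (ρ : Set (Fin k → α)) : Prop :=
  ∀ r ∈ ρ, (f ∘ r) ∈ ρ

/-- The `ℓ`-orbit `a^H = {σ ∘ a : σ ∈ H}`. -/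
def orbitRel {ℓ n : ℕ} (H : Subgroup (Equiv.Perm (Fin n))) (a : Fin ℓ → Fin n) :
    Set (Fin ℓ → Fin n) :=
  {x | ∃ σ ∈ H, x = ⇑σ ∘ a}

/-- The reduction `red(u) = h_{range u}⁻¹ ∘ u` of a tuple with pairwise distinct
entries. -/
def red {k n : ℕ} (u : Fin k → Fin n) (hu : Function.Injective u) : Fin k → Fin k :=
  fun i =>
    ((Finset.univ.image u).orderIsoOfFin
      (by rw [Finset.card_image_of_injective _ hu]; simp)).symm
      ⟨u i, Finset.mem_image_of_mem _ (Finset.mem_univ i)⟩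

/-- `red(ρ) = {red(r) : r ∈ ρ}` for a set `ρ` of tuples with pairwise distinct entries. -/
def redSet {k n : ℕ} (ρ : Set (Fin k → Fin n)) : Set (Fin k → Fin k) :=
  {v | ∃ (r : Fin k → Fin n) (_ : r ∈ ρ) (hr : Function.Injective r), v = red r hr}

/-- `ρ̌ := {h_I⁻¹ ∘ r : r ∈ ρ, range r ⊆ I, I an ℓ-element subset of [n]}`. -/
def checkRel (ℓ : ℕ) {k n : ℕ} (ρ : Set (Fin k → Fin n)) : Set (Fin k → Fin ℓ) :=
  {s | ∃ (r : Fin k → Fin n) (_ : r ∈ ρ) (I : Finset (Fin n)) (hI : I.card = ℓ)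
        (hr : ∀ j, r j ∈ I), s = fun j => (I.orderIsoOfFin hI).symm ⟨r j, hr j⟩}

/-- `σ̂ := {h_J ∘ s : s ∈ σ, J an ℓ-element subset of [n]}`. -/
def hatRel (n : ℕ) {k ℓ : ℕ} (σ : Set (Fin k → Fin ℓ)) : Set (Fin k → Fin n) :=
  {r | ∃ (s : Fin k → Fin ℓ) (_ : s ∈ σ) (J : Finset (Fin n)) (hJ : J.card = ℓ),
        r = hmap J hJ ∘ s}

/-- `ρ` is a pattern closed relation (pc-relation): for every `r ∈ ρ` and all
`ℓ`-element subsets `I, J ⊆ [n]` with `range r ⊆ I`, the tuple `h_J ∘ h_I⁻¹ ∘ r`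
belongs to `ρ`. -/
def IsPC (ℓ : ℕ) {k n : ℕ} (ρ : Set (Fin k → Fin n)) : Prop :=
  ∀ r ∈ ρ, ∀ (I J : Finset (Fin n)) (hI : I.card = ℓ) (hJ : J.card = ℓ)
    (hr : ∀ j, r j ∈ I),
    (fun j => hmap J hJ ((I.orderIsoOfFin hI).symm ⟨r j, hr j⟩)) ∈ ρ
/-- A subset of a symmetric group is (the underlying set of) a subgroup iff it is
nonempty and closed under composition and inverses. -/
def IsSubgroupSet {m : ℕ} (C : Set (Equiv.Perm (Fin m))) : Prop :=
  C.Nonempty ∧ (∀ a ∈ C, ∀ b ∈ C, a * b ∈ C) ∧ (∀ a ∈ C, a⁻¹ ∈ C)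

theorem patt_lt_patt_iff {ℓ n : ℕ} (π : Equiv.Perm (Fin n)) (I : Finset (Fin n))
    (hI : I.card = ℓ) (i j : Fin ℓ) :
    patt π I hI i < patt π I hI j ↔ π (hmap I hI i) < π (hmap I hI j) := by
  exact OrderIso.lt_iff_lt ((I.image ⇑π).orderIsoOfFin
    (by rw [Finset.card_image_of_injective _ π.injective, hI])).symm

theorem hmap_strictMono {ℓ n : ℕ} (I : Finset (Fin n)) (hI : I.card = ℓ) :
    StrictMono (hmap I hI) := fun _ _ h => (I.orderIsoOfFin hI).strictMono h

theorem hmap_patt {ℓ n : ℕ} (π : Equiv.Perm (Fin n)) (I : Finset (Fin n))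
    (hI : I.card = ℓ) (hI' : (I.image π).card = ℓ) (i : Fin ℓ) :
    hmap (I.image π) hI' (patt π I hI i) = π (hmap I hI i) := by
  simp [patt, hmap, Equiv.subtypeEquiv]

theorem patt_one {ℓ n : ℕ} (I : Finset (Fin n)) (hI : I.card = ℓ) :
    patt (1 : Equiv.Perm (Fin n)) I hI = 1 := by
  have h1 : I.image (1 : Equiv.Perm (Fin n)) = I := by simp
  ext i : 1
  apply hmap_injective I hI
  have := hmap_patt 1 I hI (by rw [h1, hI]) i
  simp only [h1] at this
  simpa using this

theorem patt_mul {ℓ n : ℕ} (σ τ : Equiv.Perm (Fin n)) (I : Finset (Fin n))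
    (hI : I.card = ℓ) (hI' : (I.image τ).card = ℓ) :
    patt (σ * τ) I hI = patt σ (I.image τ) hI' * patt τ I hI := by
  have h1 : I.image (σ * τ) = (I.image τ).image σ := by
    rw [Finset.image_image]; rfl
  have h2 : ((I.image τ).image σ).card = ℓ := by
    rw [Finset.card_image_of_injective _ σ.injective, hI']
  ext i : 1
  apply hmap_injective _ h2
  have h3 := hmap_patt (σ * τ) I hI (by rw [h1, h2]) i
  simp only [h1] at h3
  rw [h3, Equiv.Perm.mul_apply, Equiv.Perm.mul_apply, hmap_patt σ _ hI' h2,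
    hmap_patt τ I hI hI']

theorem inv_mem_pattSet {ℓ n : ℕ} {σ : Equiv.Perm (Fin ℓ)} {π : Equiv.Perm (Fin n)}
    (h : σ ∈ PattSet ℓ π) : σ⁻¹ ∈ PattSet ℓ π⁻¹ := by
  obtain ⟨I, hI, rfl⟩ := h
  have hI' : (I.image π).card = ℓ := by
    rw [Finset.card_image_of_injective _ π.injective, hI]
  refine ⟨I.image π, hI', ?_⟩
  rw [inv_eq_iff_mul_eq_one, mul_eq_one_iff_eq_inv, eq_comm, inv_eq_iff_mul_eq_one,
    ← patt_mul, inv_mul_cancel, patt_one]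

theorem pattSet_one {ℓ n : ℕ} (hn : ℓ ≤ n) :
    PattSet ℓ (1 : Equiv.Perm (Fin n)) = {1} := by
  ext σ
  constructor
  · rintro ⟨I, hI, rfl⟩
    exact patt_one I hI
  · rintro rfl
    obtain ⟨I, -, hI⟩ := Finset.exists_subset_card_eq (s := (univ : Finset (Fin n)))
      (by simpa using hn)
    exact ⟨I, hI, (patt_one I hI).symm⟩

theorem IsSubgroupSet.one_mem {m : ℕ} {C : Set (Equiv.Perm (Fin m))} (h : IsSubgroupSet C) :
    1 ∈ C := by
  obtain ⟨⟨a, ha⟩, hmul, hinv⟩ := h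
  simpa using hmul a ha _ (hinv a ha)

theorem IsSubgroupSet.compSet {ℓ n : ℕ} (hn : ℓ ≤ n) {S : Set (Equiv.Perm (Fin ℓ))}
    (h : IsSubgroupSet S) : IsSubgroupSet (CompSet n S) := by
  refine ⟨⟨1, ?_⟩, ?_, ?_⟩
  · simpa [CompSet, pattSet_one hn] using h.one_mem
  · rintro a ha b hb _ ⟨I, hI, rfl⟩
    have hI' : (I.image b).card = ℓ := by
      rw [Finset.card_image_of_injective _ b.injective, hI]
    rw [patt_mul a b I hI hI']
    exact h.2.1 _ (ha ⟨_, _, rfl⟩) _ (hb ⟨_, _, rfl⟩)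
  · intro a ha σ hσ
    have := inv_mem_pattSet hσ
    rw [inv_inv] at this
    simpa using h.2.2 _ (ha this)

theorem IsSubgroupSet.one_mem_of_compSet {ℓ n : ℕ} (hn : ℓ ≤ n)
    {S : Set (Equiv.Perm (Fin ℓ))} (h : IsSubgroupSet (CompSet n S)) : 1 ∈ S :=
  h.one_mem (by rw [pattSet_one hn]; rfl)

theorem perm_three_eq_of_lt_iff : ∀ σ τ : Equiv.Perm (Fin 3),
    (σ 0 < σ 1 ↔ τ 0 < τ 1) → (σ 0 < σ 2 ↔ τ 0 < τ 2) → (σ 1 < σ 2 ↔ τ 1 < τ 2) →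
    σ = τ := by
  decide

theorem perm_three_cases (σ : Equiv.Perm (Fin 3)) :
    (σ = 1 ∧ σ 0 < σ 1 ∧ σ 0 < σ 2 ∧ σ 1 < σ 2) ∨
    (σ = swap 1 2 ∧ σ 0 < σ 1 ∧ σ 0 < σ 2 ∧ ¬ σ 1 < σ 2) ∨
    (σ = swap 0 1 ∧ ¬ σ 0 < σ 1 ∧ σ 0 < σ 2 ∧ σ 1 < σ 2) ∨
    (σ = finRotate 3 ∧ σ 0 < σ 1 ∧ ¬ σ 0 < σ 2 ∧ ¬ σ 1 < σ 2) ∨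
    (σ = (finRotate 3)⁻¹ ∧ ¬ σ 0 < σ 1 ∧ ¬ σ 0 < σ 2 ∧ σ 1 < σ 2) ∨
    (σ = Fin.revPerm ∧ ¬ σ 0 < σ 1 ∧ ¬ σ 0 < σ 2 ∧ ¬ σ 1 < σ 2) := by
  decide +revert

theorem mem_pattSet_three {n : ℕ} {σ : Equiv.Perm (Fin 3)} {π : Equiv.Perm (Fin n)} :
    σ ∈ PattSet 3 π ↔ ∃ x y z : Fin n, x < y ∧ y < z ∧ (σ 0 < σ 1 ↔ π x < π y) ∧
      (σ 0 < σ 2 ↔ π x < π z) ∧ (σ 1 < σ 2 ↔ π y < π z) := by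
  constructor
  · rintro ⟨I, hI, rfl⟩
    exact ⟨hmap I hI 0, hmap I hI 1, hmap I hI 2, hmap_strictMono I hI (by decide),
      hmap_strictMono I hI (by decide), patt_lt_patt_iff .., patt_lt_patt_iff ..,
      patt_lt_patt_iff ..⟩
  · rintro ⟨x, y, z, hxy, hyz, h01, h02, h12⟩
    have hI : ({x, y, z} : Finset (Fin n)).card = 3 :=
      Finset.card_eq_three.mpr ⟨x, y, z, hxy.ne, (hxy.trans hyz).ne, hyz.ne, rfl⟩
    have hf : ![x, y, z] = hmap {x, y, z} hI := by
      apply Finset.orderEmbOfFin_unique hI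
      · intro i; fin_cases i <;> simp
      · rw [Fin.strictMono_iff_lt_succ]
        intro i; fin_cases i <;> simpa
    have h0 : hmap {x, y, z} hI 0 = x := by rw [← hf]; rfl
    have h1 : hmap {x, y, z} hI 1 = y := by rw [← hf]; rfl
    have h2 : hmap {x, y, z} hI 2 = z := by rw [← hf]; rfl
    refine ⟨{x, y, z}, hI, perm_three_eq_of_lt_iff _ _ ?_ ?_ ?_⟩ <;>
      simp only [patt_lt_patt_iff, h0, h1, h2, h01, h02, h12]

theorem val_finRotate {m : ℕ} (x : Fin (m + 3)) :
    (finRotate (m + 3) x : ℕ) = if (x : ℕ) = m + 2 then 0 else (x : ℕ) + 1 := by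
  rw [coe_finRotate]
  simp only [Fin.ext_iff, Fin.val_last]

theorem val_swap {n : ℕ} (a b x : Fin n) :
    (swap a b x : ℕ) =
      if (x : ℕ) = a then (b : ℕ) else if (x : ℕ) = b then (a : ℕ) else (x : ℕ) := by
  rw [Equiv.swap_apply_def]
  simp only [Fin.ext_iff]
  split_ifs <;> rfl

theorem exists_of_mem_pattSet_three {n : ℕ} {σ : Equiv.Perm (Fin 3)} {π : Equiv.Perm (Fin n)}
    (h : σ ∈ PattSet 3 π) : ∃ x y z : Fin n, (x : ℕ) < y ∧ (y : ℕ) < z ∧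
      ((σ = 1 ∧ (π x : ℕ) < π y ∧ (π x : ℕ) < π z ∧ (π y : ℕ) < π z) ∨
      (σ = swap 1 2 ∧ (π x : ℕ) < π y ∧ (π x : ℕ) < π z ∧ ¬ (π y : ℕ) < π z) ∨
      (σ = swap 0 1 ∧ ¬ (π x : ℕ) < π y ∧ (π x : ℕ) < π z ∧ (π y : ℕ) < π z) ∨
      (σ = finRotate 3 ∧ (π x : ℕ) < π y ∧ ¬ (π x : ℕ) < π z ∧ ¬ (π y : ℕ) < π z) ∨
      (σ = (finRotate 3)⁻¹ ∧ ¬ (π x : ℕ) < π y ∧ ¬ (π x : ℕ) < π z ∧ (π y : ℕ) < π z) ∨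
      (σ = Fin.revPerm ∧ ¬ (π x : ℕ) < π y ∧ ¬ (π x : ℕ) < π z ∧ ¬ (π y : ℕ) < π z)) := by
  obtain ⟨x, y, z, hxy, hyz, h01, h02, h12⟩ := mem_pattSet_three.mp h
  refine ⟨x, y, z, hxy, hyz, ?_⟩
  have := perm_three_cases σ
  rwa [h01, h02, h12] at this

theorem mem_pattSet_of_chain {n : ℕ} {σ : Equiv.Perm (Fin 3)} {π : Equiv.Perm (Fin n)}
    (x y z : ℕ) (hz : z < n) (hxy : x < y) (hyz : y < z)
    (h01 : σ 0 < σ 1 ↔ (π ⟨x, by omega⟩ : ℕ) < π ⟨y, by omega⟩)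
    (h02 : σ 0 < σ 2 ↔ (π ⟨x, by omega⟩ : ℕ) < π ⟨z, hz⟩)
    (h12 : σ 1 < σ 2 ↔ (π ⟨y, by omega⟩ : ℕ) < π ⟨z, hz⟩) : σ ∈ PattSet 3 π :=
  mem_pattSet_three.mpr ⟨⟨x, by omega⟩, ⟨y, by omega⟩, ⟨z, hz⟩, hxy, hyz, h01, h02, h12⟩

theorem pattSet_finRotate_subset (m : ℕ) :
    PattSet 3 (finRotate (m + 3)) ⊆ {1, finRotate 3} := by
  intro σ hσ
  obtain ⟨x, y, z, hxy, hyz, h⟩ := exists_of_mem_pattSet_three hσ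
  simp only [val_finRotate] at h
  rcases h with ⟨rfl, h⟩ | ⟨rfl, h⟩ | ⟨rfl, h⟩ | ⟨rfl, h⟩ | ⟨rfl, h⟩ | ⟨rfl, h⟩ <;>
    first | simp; done | grind

theorem pattSet_swap_first_subset (m : ℕ) :
    PattSet 3 (swap 0 1 : Equiv.Perm (Fin (m + 3))) ⊆ {1, swap 0 1} := by
  intro σ hσ
  obtain ⟨x, y, z, hxy, hyz, h⟩ := exists_of_mem_pattSet_three hσ
  simp only [val_swap, Fin.val_zero, Fin.val_one] at h
  rcases h with ⟨rfl, h⟩ | ⟨rfl, h⟩ | ⟨rfl, h⟩ | ⟨rfl, h⟩ | ⟨rfl, h⟩ | ⟨rfl, h⟩ <;>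
    first | simp; done | grind

theorem pattSet_swap_second_subset (m : ℕ) :
    PattSet 3 (swap 1 2 : Equiv.Perm (Fin (m + 3))) ⊆ {1, swap 1 2, swap 0 1} := by
  intro σ hσ
  obtain ⟨x, y, z, hxy, hyz, h⟩ := exists_of_mem_pattSet_three hσ
  simp only [val_swap, Fin.val_two, Fin.val_one] at h
  rcases h with ⟨rfl, h⟩ | ⟨rfl, h⟩ | ⟨rfl, h⟩ | ⟨rfl, h⟩ | ⟨rfl, h⟩ | ⟨rfl, h⟩ <;>
    first | simp; done | grind

theorem pattSet_swap_last_subset (m : ℕ) :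
    PattSet 3 (swap ⟨m + 1, by omega⟩ ⟨m + 2, by omega⟩ : Equiv.Perm (Fin (m + 3))) ⊆
      {1, swap 1 2} := by
  intro σ hσ
  obtain ⟨x, y, z, hxy, hyz, h⟩ := exists_of_mem_pattSet_three hσ
  simp only [val_swap] at h
  rcases h with ⟨rfl, h⟩ | ⟨rfl, h⟩ | ⟨rfl, h⟩ | ⟨rfl, h⟩ | ⟨rfl, h⟩ | ⟨rfl, h⟩ <;>
    first | simp; done | grind

theorem pattSet_revPerm_subset (n : ℕ) :
    PattSet 3 (Fin.revPerm : Equiv.Perm (Fin n)) ⊆ {Fin.revPerm} := by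
  intro σ hσ
  obtain ⟨x, y, z, hxy, hyz, h⟩ := exists_of_mem_pattSet_three hσ
  simp only [Fin.revPerm_apply, Fin.val_rev] at h
  rcases h with ⟨rfl, h⟩ | ⟨rfl, h⟩ | ⟨rfl, h⟩ | ⟨rfl, h⟩ | ⟨rfl, h⟩ | ⟨rfl, h⟩ <;>
    first | simp; done | (exfalso; omega)

theorem isSubgroupSet_three {S : Set (Equiv.Perm (Fin 3))} (h1 : 1 ∈ S)
    (hinv : ∀ σ ∈ S, σ⁻¹ ∈ S)
    (hab : swap 1 2 ∈ S → swap 0 1 ∈ S → finRotate 3 ∈ S)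
    (hac : swap 1 2 ∈ S → finRotate 3 ∈ S → swap 0 1 ∈ S ∧ Fin.revPerm ∈ S)
    (hbc : swap 0 1 ∈ S → finRotate 3 ∈ S → Fin.revPerm ∈ S)
    (hra : Fin.revPerm ∈ S → swap 1 2 ∈ S → finRotate 3 ∈ S)
    (hrb : Fin.revPerm ∈ S → swap 0 1 ∈ S → finRotate 3 ∈ S)
    (hrc : Fin.revPerm ∈ S → finRotate 3 ∈ S → swap 1 2 ∈ S) : IsSubgroupSet S := by
  have hc : finRotate 3 ∈ S → (finRotate 3)⁻¹ ∈ S := hinv _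
  have hd : (finRotate 3)⁻¹ ∈ S → finRotate 3 ∈ S := fun h => by simpa using hinv _ h
  refine ⟨⟨1, h1⟩, fun x hx y hy => ?_, hinv⟩
  rcases perm_three_cases x with h | h | h | h | h | h <;>
  rcases perm_three_cases y with h' | h' | h' | h' | h' | h' <;>
  obtain ⟨rfl, -⟩ := h <;> obtain ⟨rfl, -⟩ := h' <;>
  rcases perm_three_cases (_ * _) with h | h | h | h | h | h <;>
  first
  | exact absurd h.1 (by decide)
  | (rw [h.1]; clear h hinv; grind)

theorem IsSubgroupSet.of_compSet_three {m : ℕ} {S : Set (Equiv.Perm (Fin 3))}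
    (h : IsSubgroupSet (CompSet (m + 3) S)) : IsSubgroupSet S := by
  have h1 : 1 ∈ S := h.one_mem_of_compSet (by omega)
  obtain ⟨-, hmul, hinv⟩ := h
  have ha : swap 1 2 ∈ S →
      (swap ⟨m + 1, by omega⟩ ⟨m + 2, by omega⟩ : Equiv.Perm (Fin (m + 3))) ∈ CompSet _ S :=
    fun ha => (pattSet_swap_last_subset m).trans (by simp [Set.insert_subset_iff, *])
  have hb : swap 0 1 ∈ S → (swap 0 1 : Equiv.Perm (Fin (m + 3))) ∈ CompSet _ S :=
    fun hb => (pattSet_swap_first_subset m).trans (by simp [Set.insert_subset_iff, *])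
  have hab : swap 1 2 ∈ S → swap 0 1 ∈ S →
      (swap 1 2 : Equiv.Perm (Fin (m + 3))) ∈ CompSet _ S :=
    fun ha hb => (pattSet_swap_second_subset m).trans (by simp [Set.insert_subset_iff, *])
  have hc : finRotate 3 ∈ S → finRotate (m + 3) ∈ CompSet _ S :=
    fun hc => (pattSet_finRotate_subset m).trans (by simp [Set.insert_subset_iff, *])
  have hr : Fin.revPerm ∈ S → (Fin.revPerm : Equiv.Perm (Fin (m + 3))) ∈ CompSet _ S :=
    fun hr => (pattSet_revPerm_subset _).trans (by simp [*])
  have rotate_mem : finRotate 3 ∈ PattSet 3 (finRotate (m + 3)) := by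
    refine mem_pattSet_of_chain 0 1 (m + 2) (by omega) (by omega) (by omega) ?_ ?_ ?_ <;>
      simp +decide only [val_finRotate] <;> grind
  have rotate_inv : finRotate 3 ∈ S → (finRotate 3)⁻¹ ∈ S :=
    fun h => hinv _ (hc h) (inv_mem_pattSet rotate_mem)
  have inv_rotate : (finRotate 3)⁻¹ ∈ S → finRotate 3 ∈ S := by
    intro h
    have : (finRotate (m + 3))⁻¹ ∈ CompSet _ S := by
      intro σ hσ
      have := pattSet_finRotate_subset m (by simpa using inv_mem_pattSet hσ)
      rcases this with h' | h'
      · rwa [inv_eq_one.mp h']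
      · rwa [inv_eq_iff_eq_inv.mp h']
    have := hinv _ this
    rw [inv_inv] at this
    exact this rotate_mem
  refine isSubgroupSet_three h1 ?_ ?_ ?_ ?_ ?_ ?_ ?_
  · intro σ hσ
    rcases perm_three_cases σ with ⟨rfl, -⟩ | ⟨rfl, -⟩ | ⟨rfl, -⟩ | ⟨rfl, -⟩ | ⟨rfl, -⟩ |
      ⟨rfl, -⟩
    · simpa using hσ
    · simpa using hσ
    · simpa using hσ
    · exact rotate_inv hσ
    · simpa using inv_rotate hσ
    · exact hσ
  · intro h h'
    apply hmul _ (hb h') _ (hab h h')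
    refine mem_pattSet_of_chain 0 1 2 (by omega) (by omega) (by omega) ?_ ?_ ?_ <;>
      simp +decide only [Equiv.Perm.mul_apply, val_swap, Fin.val_zero, Fin.val_one, Fin.val_two]
  · intro h h'
    constructor
    · apply hmul _ (hc h') _ (ha h)
      refine mem_pattSet_of_chain 0 (m + 1) (m + 2) (by omega) (by omega) (by omega) ?_ ?_ ?_ <;>
        simp +decide only [Equiv.Perm.mul_apply, val_swap, val_finRotate] <;> grind
    · apply hmul _ (ha h) _ (hc h')
      refine mem_pattSet_of_chain m (m + 1) (m + 2) (by omega) (by omega) (by omega) ?_ ?_ ?_ <;>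
        simp +decide only [Equiv.Perm.mul_apply, val_swap, val_finRotate] <;> grind
  · intro h h'
    apply hmul _ (hc h') _ (hb h)
    refine mem_pattSet_of_chain 0 1 (m + 2) (by omega) (by omega) (by omega) ?_ ?_ ?_ <;>
      simp +decide only [Equiv.Perm.mul_apply, val_swap, val_finRotate, Fin.val_zero, Fin.val_one] <;>
      grind
  · intro h h'
    apply hmul _ (ha h') _ (hr h)
    refine mem_pattSet_of_chain 0 1 (m + 2) (by omega) (by omega) (by omega) ?_ ?_ ?_ <;>
      simp +decide only [Equiv.Perm.mul_apply, val_swap, Fin.revPerm_apply, Fin.val_rev] <;>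
      grind
  · intro h h'
    apply inv_rotate
    apply hmul _ (hb h') _ (hr h)
    refine mem_pattSet_of_chain 0 (m + 1) (m + 2) (by omega) (by omega) (by omega) ?_ ?_ ?_ <;>
      simp +decide only [Equiv.Perm.mul_apply, val_swap, Fin.revPerm_apply, Fin.val_rev,
        Fin.val_zero, Fin.val_one] <;>
      grind
  · intro h h'
    apply hmul _ (hc h') _ (hr h)
    refine mem_pattSet_of_chain 0 1 2 (by omega) (by omega) (by omega) ?_ ?_ ?_ <;>
      simp +decide only [Equiv.Perm.mul_apply, val_finRotate, Fin.revPerm_apply, Fin.val_rev] <;>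
      grind

theorem isSubgroupSet_of_one_mem {ℓ : ℕ} (h : ℓ ≤ 2) {S : Set (Equiv.Perm (Fin ℓ))}
    (h1 : 1 ∈ S) : IsSubgroupSet S := by
  have key : ∀ a b : Equiv.Perm (Fin ℓ), (a * b = 1 ∨ a * b = a ∨ a * b = b) ∧ a⁻¹ = a := by
    interval_cases ℓ <;> decide
  refine ⟨⟨1, h1⟩, fun a ha b hb => ?_, fun a ha => (key a a).2.symm ▸ ha⟩
  rcases (key a b).1 with h | h | h <;> rwa [h]

/-- Proposition 3.5: for `ℓ ≤ 3` and `ℓ ≤ n`, `Comp^n(S)` is a subgroup of `S_n` iff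
`S` is a subgroup of `S_ℓ`. -/
theorem stmt8 (ℓ n : ℕ) (hℓ : 0 < ℓ) (hn : ℓ ≤ n) (h3 : ℓ ≤ 3)
    (S : Set (Equiv.Perm (Fin ℓ))) :
    IsSubgroupSet (CompSet n S) ↔ IsSubgroupSet S := by
  refine ⟨fun h => ?_, fun h => h.compSet hn⟩
  obtain h2 | rfl : ℓ ≤ 2 ∨ ℓ = 3 := by omega
  · exact isSubgroupSet_of_one_mem h2 (h.one_mem_of_compSet hn)
  · obtain ⟨m, rfl⟩ := Nat.exists_eq_add_of_le' hn
    exact h.of_compSet_three
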